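/- The linear map Ψ : Hom(C, V₀) → Hom(ker ∂, coker ∂), Ψ(φ) = π ∘ φ ∘ ι, is surjective with kernel range δ₁. Consequently Ψ induces a linear isomorphism H¹ := Hom(C, V₀) / range δ₁ ≅ Hom(ker ∂, coker ∂); this computes the degree 1 linear deformation cohomology of the 2-vector space determined by ∂. -/

import Mathlib

/-! Degree 1 linear deformation cohomology of a 2-vector space:
`Ψ : Hom(C, V₀) → Hom(ker ∂, coker ∂)`, `Ψ(φ) = π ∘ φ ∘ ι`, is surjective with
kernel `range δ₁`, hence `H¹ = Hom(C, V₀) / range δ₁ ≅ Hom(ker ∂, coker ∂)`. -/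

variable {k C V₀ : Type*} [Field k] [AddCommGroup C] [Module k C]
  [AddCommGroup V₀] [Module k V₀]

/-- The differential `δ₁ : End(C) × End(V₀) → Hom(C, V₀)`,
`δ₁(γ₁, γ₂) = γ₂ ∘ ∂ − ∂ ∘ γ₁`. -/
def delta1 (d : C →ₗ[k] V₀) :
    (Module.End k C × Module.End k V₀) →ₗ[k] (C →ₗ[k] V₀) where
  toFun γ := γ.2 ∘ₗ d - d ∘ₗ γ.1
  map_add' a b := by
    ext x
    simp [LinearMap.add_comp, LinearMap.comp_add]
    abel
  map_smul' r a := by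
    ext x
    simp [LinearMap.smul_comp, LinearMap.comp_smul, smul_sub]

/-- The map `Ψ : Hom(C, V₀) → Hom(ker ∂, coker ∂)`, `Ψ(φ) = π ∘ φ ∘ ι`. -/
def Psi (d : C →ₗ[k] V₀) :
    (C →ₗ[k] V₀) →ₗ[k] (LinearMap.ker d →ₗ[k] V₀ ⧸ LinearMap.range d) where
  toFun φ := (LinearMap.range d).mkQ ∘ₗ φ ∘ₗ (LinearMap.ker d).subtype
  map_add' a b := by
    simp [LinearMap.add_comp, LinearMap.comp_add]
  map_smul' r a := by
    simp [LinearMap.smul_comp, LinearMap.comp_smul]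

theorem stmt6_aux (d : C →ₗ[k] V₀) : ∃ r : V₀ →ₗ[k] C, ∀ c, d (r (d c)) = d c := by
  obtain ⟨s, hs⟩ := d.rangeRestrict.exists_rightInverse_of_surjective d.range_rangeRestrict
  obtain ⟨p, hp⟩ := (LinearMap.range d).subtype.exists_leftInverse_of_injective
    (LinearMap.range d).ker_subtype
  refine ⟨s ∘ₗ p, fun c => ?_⟩
  have h1 : p (d c) = d.rangeRestrict c := LinearMap.congr_fun hp (d.rangeRestrict c)
  have h2 := LinearMap.congr_fun hs (d.rangeRestrict c)
  have h3 := congrArg Subtype.val h2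
  simp only [LinearMap.comp_apply, h1]
  exact h3

theorem stmt6 (d : C →ₗ[k] V₀) :
    Function.Surjective (Psi d) ∧
    LinearMap.ker (Psi d) = LinearMap.range (delta1 d) ∧
    ∃ e : ((C →ₗ[k] V₀) ⧸ LinearMap.range (delta1 d)) ≃ₗ[k]
          (LinearMap.ker d →ₗ[k] V₀ ⧸ LinearMap.range d),
      ∀ φ : C →ₗ[k] V₀, e (Submodule.Quotient.mk φ) = Psi d φ := by
  have hsurj : Function.Surjective (Psi d) := by
    intro f
    obtain ⟨σ, hσ⟩ := (LinearMap.range d).mkQ.exists_rightInverse_of_surjective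
      (LinearMap.range d).range_mkQ
    obtain ⟨q, hq⟩ := (LinearMap.ker d).subtype.exists_leftInverse_of_injective
      (LinearMap.ker d).ker_subtype
    refine ⟨σ ∘ₗ f ∘ₗ q, ?_⟩
    refine LinearMap.ext fun x => ?_
    have h1 : q (x : C) = x := LinearMap.congr_fun hq x
    change (LinearMap.range d).mkQ (σ (f (q (x : C)))) = f x
    rw [h1]
    exact LinearMap.congr_fun hσ (f x)
  have hker : LinearMap.ker (Psi d) = LinearMap.range (delta1 d) := by
    apply le_antisymm
    · intro φ hφ
      obtain ⟨r, hr⟩ := stmt6_aux d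
      have hφ' : ∀ c, d c = 0 → ∃ b, d b = φ c := by
        intro c hc
        have h := LinearMap.congr_fun (LinearMap.mem_ker.1 hφ) ⟨c, hc⟩
        change (LinearMap.range d).mkQ (φ c) = 0 at h
        rw [Submodule.mkQ_apply, Submodule.Quotient.mk_eq_zero] at h
        exact h
      refine ⟨(-(r ∘ₗ (φ - φ ∘ₗ r ∘ₗ d)), φ ∘ₗ r), ?_⟩
      refine LinearMap.ext fun c => ?_
      change φ (r (d c)) - d (-(r (φ c - φ (r (d c))))) = φ c
      obtain ⟨b, hb⟩ := hφ' (c - r (d c)) (by rw [map_sub, hr, sub_self])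
      rw [← map_sub φ, ← hb, map_neg, hr, hb, map_sub]
      abel
    · rintro _ ⟨⟨a, b⟩, rfl⟩
      rw [LinearMap.mem_ker]
      refine LinearMap.ext fun x => ?_
      change (LinearMap.range d).mkQ (b (d x) - d (a x)) = 0
      rw [Submodule.mkQ_apply, Submodule.Quotient.mk_eq_zero, LinearMap.mem_ker.1 x.2, map_zero,
        zero_sub]
      exact neg_mem ⟨_, rfl⟩
  exact ⟨hsurj, hker, (Submodule.quotEquivOfEq _ _ hker.symm).trans
    ((Psi d).quotKerEquivOfSurjective hsurj), fun φ => rfl⟩
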